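/- arXiv:2011.14128 — 6 statements merged into one kernel-verified Lean document; each statement's English description precedes it below -/
import Mathlib

section
/- (Module-theoretic form of Lemma 3.1.) Let R be an integral domain in which 2 ≠ 0, let e ≥ 1, let a_1, …, a_e ∈ R be pairwise distinct, let f(u) = ∏_{i=1}^{e}(u − a_i), and let A = R[u]/(f(u)). Let H be a free A-module of rank 2 with an A-bilinear pairing ⟨·,·⟩ : H × H → A that is perfect (the map H → Hom_A(H, A), x ↦ ⟨x,·⟩, is bijective) and skew-symmetric (⟨x, y⟩ = −⟨y, x⟩ for all x, y). Let 0 = F^0 ⊆ F^1 ⊆ ⋯ ⊆ F^e ⊆ H be A-submodules such that for each j with 1 ≤ j ≤ e: F^j is a direct summand of H as an R-module, F^j/F^{j−1} is a free R-module of rank 1, and (u − a_j)·F^j ⊆ F^{j−1}. Then for every j = 0, 1, …, e, the orthogonal complement of F^j equals the preimage of F^j under multiplication by t_j := ∏_{i=j+1}^{e}(u − a_i); that is, (F^j)^⊥ = {x ∈ H : t_j·x ∈ F^j}. -/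
open Polynomial

/-- The polynomial `f(u) = ∏ᵢ (u − aᵢ)`. -/
noncomputable def minpol' {R : Type*} [CommRing R] {e : ℕ} (a : Fin e → R) : R[X] :=
  ∏ i, (X - C (a i))

/-- The ring `A = R[u]/(f(u))`. -/
abbrev Aq {R : Type*} [CommRing R] {e : ℕ} (a : Fin e → R) :=
  R[X] ⧸ Ideal.span {minpol' a}

/-- The image in `A` of `tⱼ = ∏_{i=j+1}^{e}(u − aᵢ)` (indices of `a` shifted by one, so the
product is over those `i : Fin e` with `j ≤ i`). -/
noncomputable def tq {R : Type*} [CommRing R] {e : ℕ} (a : Fin e → R) (j : ℕ) : Aq a :=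
  Ideal.Quotient.mk (Ideal.span {minpol' a})
    (∏ i ∈ Finset.univ.filter (fun i : Fin e => j ≤ (i : ℕ)), (X - C (a i)))

/-- The image in `A` of `u − aⱼ` (for `1 ≤ j ≤ e`, via the index `j - 1 : Fin e`). -/
noncomputable def uel {R : Type*} [CommRing R] {e : ℕ} (a : Fin e → R) (j : ℕ)
    (h : j - 1 < e) : Aq a :=
  Ideal.Quotient.mk (Ideal.span {minpol' a}) (X - C (a ⟨j - 1, h⟩))

section Aux
variable {R : Type*} [CommRing R] {e : ℕ} (a : Fin e → R)

/-- evaluation at `a i` on the quotient -/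
noncomputable def evq (i : Fin e) : Aq a →+* R :=
  Ideal.Quotient.lift _ (evalRingHom (a i)) (by
    intro g hg
    obtain ⟨q, rfl⟩ := Ideal.mem_span_singleton.1 hg
    have : (minpol' a).eval (a i) = 0 := by
      rw [minpol', eval_prod]
      exact Finset.prod_eq_zero (Finset.mem_univ i) (by simp)
    simp [this])

lemma evq_mk (i : Fin e) (g : R[X]) :
    evq a i (Ideal.Quotient.mk _ g) = g.eval (a i) := rfl

lemma evq_algebraMap (i : Fin e) (r : R) : evq a i (algebraMap R (Aq a) r) = r := by
  change evq a i (Ideal.Quotient.mk _ (C r)) = r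
  rw [evq_mk]; simp

/-- the idempotent-like element -/
noncomputable def pq (i : Fin e) : Aq a :=
  Ideal.Quotient.mk _ (∏ k ∈ Finset.univ.erase i, (X - C (a k)))

lemma mul_pq (i : Fin e) (α : Aq a) : α * pq a i = algebraMap R (Aq a) (evq a i α) * pq a i := by
  obtain ⟨g, rfl⟩ := Ideal.Quotient.mk_surjective α
  rw [evq_mk]
  change _ = Ideal.Quotient.mk _ (C _) * _
  rw [pq, ← map_mul, ← map_mul, Ideal.Quotient.eq, ← sub_mul, Ideal.mem_span_singleton, minpol',
    ← Finset.mul_prod_erase _ _ (Finset.mem_univ i)]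
  exact mul_dvd_mul_right (X_sub_C_dvd_sub_C_eval) _

lemma evq_ext [IsDomain R] (ha : Function.Injective a) (α : Aq a) (h : ∀ i, evq a i α = 0) :
    α = 0 := by
  obtain ⟨g, rfl⟩ := Ideal.Quotient.mk_surjective α
  rw [Ideal.Quotient.eq_zero_iff_mem, Ideal.mem_span_singleton, minpol']
  by_cases hg : g = 0
  · simp [hg]
  have := (Finset.univ.val.map a).prod_X_sub_C_dvd_iff_le_roots hg
  rw [Multiset.map_map] at this
  refine this.2 ?_
  rw [Multiset.le_iff_subset (Finset.univ.nodup.map ha)]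
  intro x hx
  obtain ⟨i, -, rfl⟩ := Multiset.mem_map.1 hx
  rw [mem_roots hg]
  exact h i

lemma evq_pq_ne [IsDomain R] (ha : Function.Injective a) (i : Fin e) : evq a i (pq a i) ≠ 0 := by
  rw [pq, evq_mk, eval_prod, Finset.prod_ne_zero_iff]
  intro k hk
  have := Finset.ne_of_mem_erase hk
  simp only [eval_sub, eval_X, eval_C]
  exact sub_ne_zero.2 fun h => this (ha h).symm

lemma evq_pq_eq (i k : Fin e) (h : k ≠ i) : evq a k (pq a i) = 0 := by
  rw [pq, evq_mk, eval_prod]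
  exact Finset.prod_eq_zero (Finset.mem_erase.2 ⟨h, Finset.mem_univ k⟩) (by simp)

lemma sum_pq [IsDomain R] (ha : Function.Injective a) :
    algebraMap R (Aq a) (∏ i, evq a i (pq a i)) =
      ∑ i, algebraMap R (Aq a) (∏ k ∈ Finset.univ.erase i, evq a k (pq a k)) * pq a i := by
  rw [← sub_eq_zero]
  refine evq_ext a ha _ fun m => ?_
  rw [map_sub, evq_algebraMap, map_sum, Finset.sum_eq_single m]
  · rw [map_mul, evq_algebraMap, Finset.prod_erase_mul _ _ (Finset.mem_univ m), sub_self]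
  · intro i _ hi
    rw [map_mul, evq_pq_eq a i m hi.symm, mul_zero]
  · simp

lemma evq_uel (i : Fin e) (j : ℕ) (h : j - 1 < e) :
    evq a i (uel a j h) = a i - a ⟨j - 1, h⟩ := by
  rw [uel, evq_mk]; simp

lemma evq_tq_eq (i : Fin e) (j : ℕ) (h : j ≤ i) : evq a i (tq a j) = 0 := by
  rw [tq, evq_mk, eval_prod]
  exact Finset.prod_eq_zero (i := i) (by simp [h]) (by simp)

lemma evq_tq_ne [IsDomain R] (ha : Function.Injective a) (i : Fin e) (j : ℕ) (h : (i : ℕ) < j) :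
    evq a i (tq a j) ≠ 0 := by
  rw [tq, evq_mk, eval_prod, Finset.prod_ne_zero_iff]
  intro k hk
  simp only [Finset.mem_filter, Finset.mem_univ, true_and] at hk
  simp only [eval_sub, eval_X, eval_C]
  refine sub_ne_zero.2 fun h' => ?_
  have := ha h'
  subst this
  omega

lemma three_term {A H : Type*} [CommRing A] [AddCommGroup H] [Module A H]
    (b : Module.Basis (Fin 2) A H) (B : H →ₗ[A] H →ₗ[A] A) (halt : ∀ x, B x x = 0)
    (hskew : ∀ x y : H, B x y = - B y x) (x y z : H) :
    B x y • z + B y z • x + B z x • y = 0 := by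
  have key : ∀ x y, B x y = (b.repr x 0 * b.repr y 1 - b.repr x 1 * b.repr y 0) * B (b 0) (b 1) := by
    intro x y
    conv_lhs => rw [← b.sum_repr x, ← b.sum_repr y]
    simp only [Fin.sum_univ_two, map_add, map_smul, LinearMap.add_apply, LinearMap.smul_apply,
      smul_eq_mul, halt, hskew (b 1) (b 0)]
    ring
  apply b.repr.injective
  ext i
  simp only [map_add, map_smul, Finsupp.add_apply, Finsupp.smul_apply, smul_eq_mul, map_zero,
    Finsupp.zero_apply]
  rw [key x y, key y z, key z x]
  fin_cases i <;> simp <;> ring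

lemma three_term_zero {A H : Type*} [CommRing A] [AddCommGroup H] [Module A H]
    (b : Module.Basis (Fin 2) A H) (B : H →ₗ[A] H →ₗ[A] A) (halt : ∀ x, B x x = 0)
    (hskew : ∀ x y : H, B x y = - B y x) (x y z : H) (h : B x y = 0) :
    B y z • x = - (B z x • y) := by
  have h3 := three_term b B halt hskew x y z
  rw [h, zero_smul, zero_add] at h3
  exact eq_neg_of_add_eq_zero_left h3

end Aux

/-- module-theoretic form of Lemma 3.1: for a free rank-2 module `H` over
`A = R[u]/(∏(u − aᵢ))` with a perfect skew-symmetric `A`-bilinear pairing `B`, and a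
Pappas–Rapoport-type filtration `F`, the orthogonal complement of `F j` is the preimage of
`F j` under multiplication by `tⱼ`. -/
theorem stmt_3 {R : Type*} [CommRing R] [IsDomain R] (h2 : (2 : R) ≠ 0)
    {e : ℕ} (he : 1 ≤ e) (a : Fin e → R) (ha : Function.Injective a)
    (H : Type*) [AddCommGroup H] [Module (Aq a) H]
    [Module.Free (Aq a) H] (hrank : Module.finrank (Aq a) H = 2)
    [Module R H] [IsScalarTower R (Aq a) H]
    (B : H →ₗ[Aq a] H →ₗ[Aq a] Aq a)
    (hperf : Function.Bijective B)
    (hskew : ∀ x y : H, B x y = - B y x)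
    (F : ℕ → Submodule (Aq a) H)
    (hF0 : F 0 = ⊥)
    (hmono : ∀ j, 1 ≤ j → j ≤ e → F (j - 1) ≤ F j)
    (hsummand : ∀ j, 1 ≤ j → j ≤ e →
      ∃ Q : Submodule R H, IsCompl ((F j).restrictScalars R) Q)
    (hgraded : ∀ j, 1 ≤ j → j ≤ e → ∃ x ∈ F j,
      (∀ y ∈ F j, ∃ r : R, y - r • x ∈ F (j - 1)) ∧
      (∀ r : R, r • x ∈ F (j - 1) → r = 0))
    (hstep : ∀ j (hj1 : 1 ≤ j) (hje : j ≤ e), ∀ x ∈ F j,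
      uel a j (by omega) • x ∈ F (j - 1)) :
    ∀ j, j ≤ e → ∀ x : H,
      (∀ y ∈ F j, B x y = 0) ↔ tq a j • x ∈ F j := by
  classical
  have hnt : Nontrivial (Aq a) := (evq a ⟨0, he⟩).domain_nontrivial
  have hfin : Module.Finite (Aq a) H := Module.finite_of_finrank_pos (by omega)
  let b : Module.Basis (Fin 2) (Aq a) H := Module.finBasisOfFinrankEq _ _ hrank
  -- torsion freeness
  have htfA : ∀ (r : R) (α : Aq a), r ≠ 0 → algebraMap R (Aq a) r * α = 0 → α = 0 := by
    intro r α hr h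
    refine evq_ext a ha _ fun i => ?_
    have := congrArg (evq a i) h
    rw [map_mul, evq_algebraMap, map_zero] at this
    exact (mul_eq_zero.1 this).resolve_left hr
  have htfH : ∀ (r : R) (x : H), r ≠ 0 → r • x = 0 → x = 0 := by
    intro r x hr h
    apply b.repr.injective
    ext i
    rw [← algebraMap_smul (Aq a) r x] at h
    have := congrArg (fun z => b.repr z i) h
    simp only [map_smul, Finsupp.smul_apply, smul_eq_mul, map_zero, Finsupp.zero_apply] at this
    simpa using htfA r _ hr this
  have hsat : ∀ j, j ≤ e → ∀ (r : R) (x : H), r ≠ 0 → r • x ∈ F j → x ∈ F j := by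
    intro j hj r x hr h
    rcases Nat.eq_zero_or_pos j with rfl | hj0
    · rw [hF0, Submodule.mem_bot] at h ⊢
      exact htfH r x hr h
    obtain ⟨Q, hQ⟩ := hsummand j hj0 hj
    obtain ⟨y, hy, q, hq, rfl⟩ := Submodule.mem_sup.1
      (hQ.sup_eq_top ▸ Submodule.mem_top : x ∈ (F j).restrictScalars R ⊔ Q)
    have h1 : r • q ∈ (F j).restrictScalars R := by
      have : r • q = r • (y + q) - r • y := by rw [smul_add]; abel
      rw [this]
      exact Submodule.sub_mem _ h (Submodule.smul_mem _ r hy)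
    have h3 : r • q = 0 := by
      have : r • q ∈ (F j).restrictScalars R ⊓ Q := ⟨h1, Q.smul_mem r hq⟩
      rwa [hQ.inf_eq_bot, Submodule.mem_bot] at this
    rw [htfH r q hr h3, add_zero]
    exact hy
  have hle : ∀ i j, i ≤ j → j ≤ e → F i ≤ F j := by
    intro i j hij
    induction j, hij using Nat.le_induction with
    | base => intro _; exact le_rfl
    | succ j hij ih =>
      intro hj
      exact (ih (by omega)).trans (hmono (j + 1) (by omega) hj)
  have halt : ∀ x, B x x = 0 := by
    intro x
    refine htfA 2 _ h2 ?_
    have := hskew x x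
    rw [map_ofNat, two_mul]
    nth_rewrite 1 [this]
    simp
  have hpx : ∀ (i : Fin e) (α : Aq a) (x : H), α • pq a i • x = evq a i α • pq a i • x := by
    intro i α x
    rw [smul_smul, mul_pq, mul_smul, algebraMap_smul]
  -- `p_i` kills `F j` for `j ≤ i`
  have hkill : ∀ (i : Fin e) (j : ℕ), j ≤ (i : ℕ) → ∀ y ∈ F j, pq a i • y = 0 := by
    intro i j
    induction j with
    | zero =>
      intro _ y hy
      rw [hF0, Submodule.mem_bot] at hy
      rw [hy, smul_zero]
    | succ j ih =>
      intro hj y hy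
      have h1 := ih (by omega) _ (hstep (j + 1) (by omega) (by omega) y hy)
      rw [smul_comm, hpx, evq_uel] at h1
      refine htfH _ _ ?_ h1
      refine sub_ne_zero.2 fun h => ?_
      have := congrArg Fin.val (ha h)
      simp at this
      omega
  -- generators of the lines
  have hline : ∀ i : Fin e, ∃ l ∈ F (i + 1), l ≠ 0 ∧ (∃ l', l = pq a i • l') ∧
      ∀ y ∈ F (i + 1), ∃ s : R, pq a i • y = s • l := by
    intro i
    obtain ⟨x, hx, hgen, hfree⟩ := hgraded (i + 1) (by omega) (by omega)
    refine ⟨pq a i • x, Submodule.smul_mem _ _ hx, ?_, ⟨x, rfl⟩, ?_⟩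
    · intro h0
      refine evq_pq_ne a ha i (hfree _ ?_)
      -- p_i x ≡ ev_i(p_i) x
      have : ∃ β : Aq a, pq a i - algebraMap R (Aq a) (evq a i (pq a i)) = β * uel a (i + 1) (by simp) := by
        obtain ⟨q, hq⟩ := X_sub_C_dvd_sub_C_eval (a := a i)
          (p := ∏ k ∈ Finset.univ.erase i, (X - C (a k)))
        refine ⟨Ideal.Quotient.mk _ q, ?_⟩
        have h := congrArg (Ideal.Quotient.mk (Ideal.span {minpol' a})) hq
        rw [map_sub, map_mul, mul_comm] at h
        exact h
      obtain ⟨β, hβ⟩ := this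
      have h1 : β • (uel a (i + 1) (by simp) • x) ∈ F (i + 1 - 1) :=
        Submodule.smul_mem _ _ (hstep (i + 1) (by omega) (by omega) x hx)
      rw [smul_smul, ← hβ, sub_smul, h0, zero_sub, algebraMap_smul] at h1
      exact (Submodule.neg_mem_iff _).1 h1
    · intro y hy
      obtain ⟨r, hr⟩ := hgen y hy
      refine ⟨r, ?_⟩
      have := hkill i _ (by simp) _ hr
      rw [smul_sub, sub_eq_zero] at this
      rw [this, ← algebraMap_smul (Aq a) r x, smul_comm, algebraMap_smul]
  -- `p_i F j` is of rank one
  have hrk : ∀ (i : Fin e) (l : H), (∀ y ∈ F (i + 1), ∃ s : R, pq a i • y = s • l) →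
      ∀ j, (i : ℕ) + 1 ≤ j → j ≤ e → ∀ y ∈ F j, ∃ r s : R, r ≠ 0 ∧ r • pq a i • y = s • l := by
    intro i l hl j hij
    induction j, hij using Nat.le_induction with
    | base =>
      intro _ y hy
      obtain ⟨s, hs⟩ := hl y hy
      exact ⟨1, s, one_ne_zero, by rw [one_smul, hs]⟩
    | succ j hij ih =>
      intro hj y hy
      obtain ⟨r, s, hr, h⟩ := ih (by omega) _ (hstep (j + 1) (by omega) hj y hy)
      rw [smul_comm (pq a i), hpx, evq_uel, smul_smul] at h
      refine ⟨_, s, mul_ne_zero hr ?_, h⟩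
      refine sub_ne_zero.2 fun h => ?_
      have := congrArg Fin.val (ha h)
      simp at this
      omega
  have hBr : ∀ (r s : R) (x y : H), B (r • x) (s • y) =
      algebraMap R (Aq a) (r * s) * B x y := by
    intro r s x y
    rw [← algebraMap_smul (Aq a) r x, ← algebraMap_smul (Aq a) s y]
    simp only [map_smul, LinearMap.smul_apply, smul_eq_mul, map_mul]
    ring
  intro j hj x
  constructor
  · intro hx
    refine hsat j hj (∏ i, evq a i (pq a i)) _
      (Finset.prod_ne_zero_iff.2 fun i _ => evq_pq_ne a ha i) ?_
    rw [← algebraMap_smul (Aq a), sum_pq a ha, Finset.sum_smul]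
    refine Submodule.sum_mem _ fun i _ => ?_
    rw [mul_smul]
    refine Submodule.smul_mem _ _ ?_
    rw [smul_comm, hpx]
    rcases Nat.lt_or_ge i j with hij | hij
    swap
    · rw [evq_tq_eq a i j hij, zero_smul]
      exact Submodule.zero_mem _
    rw [← algebraMap_smul (Aq a)]
    refine Submodule.smul_mem _ _ ?_
    obtain ⟨l, hl, hl0, ⟨l', hl'⟩, -⟩ := hline i
    have hlj : l ∈ F j := hle _ _ hij hj hl
    have hz : ∃ z, B l z ≠ 0 := by
      by_contra! hz
      exact hl0 (hperf.1 (by rw [map_zero]; exact LinearMap.ext hz))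
    obtain ⟨z, hz⟩ := hz
    have hev : evq a i (B l z) ≠ 0 := by
      intro h
      refine hz (evq_ext a ha _ fun k => ?_)
      by_cases hk : k = i
      · rw [hk, h]
      · rw [hl', map_smul, LinearMap.smul_apply, smul_eq_mul, map_mul, evq_pq_eq a i k hk, zero_mul]
    refine hsat j hj _ _ hev ?_
    rw [← hpx, smul_comm]
    refine Submodule.smul_mem _ _ ?_
    rw [three_term_zero b B halt hskew x l z (hx l hlj)]
    exact Submodule.neg_mem _ (Submodule.smul_mem _ _ hlj)
  · intro hx y hy
    refine evq_ext a ha _ fun i => ?_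
    rcases Nat.lt_or_ge i j with hij | hij
    · obtain ⟨l, -, -, -, hl⟩ := hline i
      obtain ⟨r, s, hr, h⟩ := hrk i l hl j hij hj _ hx
      obtain ⟨r', s', hr', h'⟩ := hrk i l hl j hij hj y hy
      have h4 : B (r • pq a i • tq a j • x) (r' • pq a i • y) = 0 := by
        rw [h, h', hBr, halt, mul_zero]
      rw [hBr] at h4
      have h5 := congrArg (evq a i) h4
      simp only [map_smul, LinearMap.smul_apply, smul_eq_mul, map_mul, evq_algebraMap,
        map_zero] at h5
      have n1 := evq_pq_ne a ha i
      have n2 := evq_tq_ne a ha i j hij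
      simpa [hr, hr', n1, n2] using h5
    · have h0 := hkill i j hij y hy
      have h5 := congrArg (fun w => evq a i (B x w)) h0
      simp only [map_smul, smul_eq_mul, map_mul, map_zero] at h5
      exact (mul_eq_zero.1 h5).resolve_left (evq_pq_ne a ha i)
end

section
/- Let n ≥ 1 be an integer and ν : ℤ/nℤ → ℤ a function with ∏_{r ∈ ℤ/nℤ} ν(r) ≠ 1. In the free abelian group ℤ^{ℤ/nℤ} with standard basis (e_r), define h_r := ν(r)·e_{r−1} − e_r for each r ∈ ℤ/nℤ. Then the subgroup Λ generated by {h_r : r ∈ ℤ/nℤ} has finite index in ℤ^{ℤ/nℤ}, equal to |∏_{r ∈ ℤ/nℤ} ν(r) − 1|. -/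
theorem stmt_7_aux_prod (n : ℕ) [NeZero n] (ν : ZMod n → ℤ) :
    ∏ i ∈ Finset.range n, ν ((i : ZMod n) + 1) = ∏ r : ZMod n, ν r := by
  refine Finset.prod_bij' (fun i _ => (i : ZMod n) + 1) (fun r _ => (r - 1).val) ?_ ?_ ?_ ?_ ?_
  · intro i _; simp
  · intro r _; simpa using ZMod.val_lt (r - 1)
  · intro i hi
    simp only [add_sub_cancel_right]
    exact ZMod.val_cast_of_lt (by simpa using hi)
  · intro r _; simp
  · intro i _; rfl

/-- in `ℤ^{ℤ/nℤ}` (with `n ≥ 1`), if `∏_r ν(r) ≠ 1` then the subgroup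
generated by the vectors `h_r = ν(r)·e_{r−1} − e_r` has finite index equal to
`|∏_r ν(r) − 1|`. -/
theorem stmt_7 (n : ℕ) [NeZero n] (ν : ZMod n → ℤ)
    (hν : ∏ r : ZMod n, ν r ≠ 1) :
    (Submodule.span ℤ
        (Set.range fun r : ZMod n =>
          (ν r • Pi.single (r - 1) (1 : ℤ) - Pi.single r 1 : ZMod n → ℤ))).toAddSubgroup.index =
      ((∏ r : ZMod n, ν r) - 1).natAbs := by
  set P := ∏ r : ZMod n, ν r with hP
  set L := Submodule.span ℤ
        (Set.range fun r : ZMod n =>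
          (ν r • Pi.single (r - 1) (1 : ℤ) - Pi.single r 1 : ZMod n → ℤ)) with hL
  set N := (P - 1).natAbs with hN
  let c : ℕ → ℤ := fun k => ∏ i ∈ Finset.range k, ν ((i : ZMod n) + 1)
  have c0 : c 0 = 1 := by simp [c]
  have cs : ∀ k, c (k + 1) = c k * ν ((k : ZMod n) + 1) := fun k => Finset.prod_range_succ _ _
  have cn : c n = P := stmt_7_aux_prod n ν
  have hPN : ((P : ℤ) : ZMod N) = 1 := by
    have : ((P - 1 : ℤ) : ZMod N) = 0 := by
      rw [ZMod.intCast_zmod_eq_zero_iff_dvd]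
      exact Int.natAbs_dvd.mpr dvd_rfl
    push_cast at this
    exact sub_eq_zero.mp this
  have hmem : ∀ r : ZMod n,
      (ν r • Pi.single (r - 1) (1 : ℤ) - Pi.single r 1 : ZMod n → ℤ) ∈ L :=
    fun r => Submodule.subset_span ⟨r, rfl⟩
  have he : ∀ k : ℕ,
      (Pi.single (k : ZMod n) (1 : ℤ) - c k • Pi.single 0 1 : ZMod n → ℤ) ∈ L := by
    intro k
    induction k with
    | zero => simp [c0]
    | succ k ih =>
      have h1 := hmem ((k : ZMod n) + 1)
      rw [add_sub_cancel_right] at h1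
      have h2 := L.sub_mem (L.smul_mem (ν ((k : ZMod n) + 1)) ih) h1
      convert h2 using 1
      rw [cs]
      push_cast
      module
  have hP0 : ((P - 1) • Pi.single 0 1 : ZMod n → ℤ) ∈ L := by
    have h := L.neg_mem (he n)
    rw [cn, ZMod.natCast_self] at h
    convert h using 1
    module
  let ψ : (ZMod n → ℤ) →ₗ[ℤ] ℤ := Fintype.linearCombination ℤ (fun r : ZMod n => c r.val)
  have hψ : ∀ x, ψ x = ∑ r, x r * c r.val := fun x => by
    simp [ψ, Fintype.linearCombination_apply]
  have hψs : ∀ r, ψ (Pi.single r 1) = c r.val := fun r => by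
    simp [hψ, Pi.single_apply]
  let φ : (ZMod n → ℤ) →+ ZMod N := (Int.castAddHom (ZMod N)).comp ψ.toAddMonoidHom
  have hφ : ∀ x, φ x = ((ψ x : ℤ) : ZMod N) := fun x => rfl
  have hred : ∀ x : ZMod n → ℤ, x - ψ x • Pi.single 0 1 ∈ L := by
    intro x
    have : x - ψ x • Pi.single 0 1 =
        ∑ r, x r • (Pi.single r (1 : ℤ) - c r.val • Pi.single 0 1 : ZMod n → ℤ) := by
      simp only [smul_sub, Finset.sum_sub_distrib, smul_smul, ← Finset.sum_smul, ← hψ]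
      congr 1
      exact pi_eq_sum_univ' x |>.trans (by simp)
    rw [this]
    refine L.sum_mem fun r _ => L.smul_mem _ ?_
    have := he r.val
    rwa [ZMod.natCast_zmod_val] at this
  have hker : L.toAddSubgroup = φ.ker := by
    ext x
    rw [Submodule.mem_toAddSubgroup, AddMonoidHom.mem_ker, hφ]
    constructor
    · intro hx
      induction hx using Submodule.span_induction with
      | mem x hx =>
        obtain ⟨r, rfl⟩ := hx
        obtain ⟨k, hk, rfl⟩ : ∃ k : ℕ, k < n ∧ r = (k : ZMod n) + 1 :=
          ⟨(r - 1).val, ZMod.val_lt _, by simp⟩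
        simp only [map_sub, map_smul, hψs, add_sub_cancel_right, smul_eq_mul]
        rw [ZMod.val_cast_of_lt hk, mul_comm, ← cs]
        rcases Nat.lt_or_ge (k + 1) n with h | h
        · have := ZMod.val_cast_of_lt h
          push_cast at this
          rw [this]; simp
        · have h' : k + 1 = n := by omega
          have h0 : (k : ZMod n) + 1 = 0 := by
            have := ZMod.natCast_self n
            rw [← h'] at this ⊢
            exact_mod_cast this
          rw [h0, h', cn, ZMod.val_zero, c0]
          simp [hPN]
      | zero => simp
      | add x y _ _ hx hy => simp [hx, hy]
      | smul a x _ hx => rw [map_smul, smul_eq_mul, Int.cast_mul, hx, mul_zero]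
    · intro hx
      rw [ZMod.intCast_zmod_eq_zero_iff_dvd] at hx
      obtain ⟨k, hk⟩ := Int.natAbs_dvd.mp hx
      have h1 := L.add_mem (hred x) (L.smul_mem k hP0)
      rw [smul_smul, mul_comm k, ← hk, sub_add_cancel] at h1
      exact h1
  have hsurj : Function.Surjective φ := by
    intro y
    obtain ⟨a, rfl⟩ := ZMod.intCast_surjective y
    refine ⟨a • Pi.single 0 1, ?_⟩
    rw [hφ, map_smul, hψs, ZMod.val_zero, c0]
    simp
  rw [hker, AddSubgroup.index_ker, AddMonoidHom.range_eq_top.mpr hsurj]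
  simp
end

section
/- Let p ≥ 2 and e, f ≥ 1 be integers, set n = e·f, and define ν : ℤ/nℤ → ℤ by ν(r) = p if r lies in the subgroup e·(ℤ/nℤ) and ν(r) = 1 otherwise. In ℤ^{ℤ/nℤ} define h_r := ν(r)·e_{r−1} − e_r, and let Λ be the subgroup generated by {h_r : r ∈ ℤ/nℤ}. Let w : ℤ/nℤ → ℤ send r to ⌊r̃/e⌋, where r̃ ∈ {0, 1, …, n−1} is the representative of r. Then the group homomorphism φ : ℤ^{ℤ/nℤ} → ℤ/(p^f − 1)ℤ defined by φ(k) = Σ_{r ∈ ℤ/nℤ} k(r)·p^{w(r)} (mod p^f − 1) is surjective with kernel exactly Λ; in particular φ induces an isomorphism ℤ^{ℤ/nℤ}/Λ ≅ ℤ/(p^f − 1)ℤ. -/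
/-- for `n = e·f`, with `ν = p` on the subgroup `e·(ℤ/nℤ)` and `ν = 1`
elsewhere, the homomorphism `φ : ℤ^{ℤ/nℤ} → ℤ/(p^f − 1)ℤ`,
`φ(k) = Σ_r k(r)·p^{⌊r̃/e⌋}`, is surjective with kernel exactly the subgroup `Λ`
generated by the vectors `h_r = ν(r)·e_{r−1} − e_r`. -/
theorem stmt_8 (p e f : ℕ) (hp : 2 ≤ p) (he : 1 ≤ e) (hf : 1 ≤ f)
    (n : ℕ) (hn : n = e * f) [NeZero n]
    (ν : ZMod n → ℤ)
    (hν1 : ∀ r : ZMod n, (∃ x : ZMod n, r = (e : ZMod n) * x) → ν r = p)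
    (hν2 : ∀ r : ZMod n, (¬ ∃ x : ZMod n, r = (e : ZMod n) * x) → ν r = 1) :
    Function.Surjective
      (fun k : ZMod n → ℤ =>
        ∑ r : ZMod n, (k r : ZMod (p ^ f - 1)) * (p : ZMod (p ^ f - 1)) ^ (r.val / e)) ∧
    ∀ k : ZMod n → ℤ,
      (∑ r : ZMod n, (k r : ZMod (p ^ f - 1)) * (p : ZMod (p ^ f - 1)) ^ (r.val / e)) = 0 ↔
      k ∈ Submodule.span ℤ
        (Set.range fun r : ZMod n =>
          (ν r • Pi.single (r - 1) (1 : ℤ) - Pi.single r 1 : ZMod n → ℤ)) := by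
  have hn0 : 0 < n := Nat.pos_of_ne_zero (NeZero.ne n)
  have hpf : 1 ≤ p ^ f := Nat.one_le_pow _ _ (by omega)
  have hM : (p : ZMod (p ^ f - 1)) ^ f = 1 := by
    have h := ZMod.natCast_self (p ^ f - 1)
    rw [Nat.cast_sub hpf] at h
    push_cast at h
    exact sub_eq_zero.mp h
  have hdiv : ∀ j : ℕ, (∃ x : ZMod n, (j : ZMod n) = (e : ZMod n) * x) ↔ e ∣ j := by
    intro j
    constructor
    · rintro ⟨x, hx⟩
      rw [← ZMod.natCast_zmod_val x, ← Nat.cast_mul, ZMod.natCast_eq_natCast_iff] at hx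
      have h2 : j ≡ e * x.val [MOD e] := hx.of_dvd ⟨f, hn⟩
      exact (h2.dvd_iff dvd_rfl).mpr ⟨_, rfl⟩
    · rintro ⟨c, rfl⟩
      exact ⟨c, by push_cast; rfl⟩
  -- the recursion for the exponents
  have hstep : ∀ j : ℕ, (p : ℤ) ^ ((j + 1) / e) = ν ((j + 1 : ℕ) : ZMod n) * (p : ℤ) ^ (j / e) := by
    intro j
    rw [Nat.succ_div]
    by_cases h : e ∣ j + 1
    · rw [hν1 _ ((hdiv _).mpr h), if_pos h]; ring
    · rw [hν2 _ (fun h' => h ((hdiv _).mp h')), if_neg h]; ring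
  set S := Submodule.span ℤ
        (Set.range fun r : ZMod n =>
          (ν r • Pi.single (r - 1) (1 : ℤ) - Pi.single r 1 : ZMod n → ℤ)) with hS
  let Φ : (ZMod n → ℤ) →+ ZMod (p ^ f - 1) :=
    { toFun := fun k => ∑ r : ZMod n,
        (k r : ZMod (p ^ f - 1)) * (p : ZMod (p ^ f - 1)) ^ (r.val / e)
      map_zero' := by simp
      map_add' := by
        intro a b
        simp [add_mul, Finset.sum_add_distrib] }
  have hΦs : ∀ r : ZMod n, Φ (Pi.single r 1) = (p : ZMod (p ^ f - 1)) ^ (r.val / e) := by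
    intro r
    change ∑ s : ZMod n, _ = _
    rw [Finset.sum_eq_single r]
    · simp
    · intro b _ hb
      simp [Pi.single_eq_of_ne hb]
    · simp
  -- every basis vector is a multiple of the zeroth one modulo the lattice
  have hmod : ∀ j : ℕ, (p : ℤ) ^ (j / e) • (Pi.single 0 1 : ZMod n → ℤ)
      - Pi.single (j : ZMod n) 1 ∈ S := by
    intro j
    induction j with
    | zero => simp
    | succ j ih =>
      have h1 : (ν ((j + 1 : ℕ) : ZMod n) • Pi.single (((j + 1 : ℕ) : ZMod n) - 1) (1 : ℤ)
          - Pi.single ((j + 1 : ℕ) : ZMod n) 1 : ZMod n → ℤ) ∈ S :=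
        Submodule.subset_span ⟨_, rfl⟩
      have h2 : ((j + 1 : ℕ) : ZMod n) - 1 = (j : ZMod n) := by push_cast; ring
      rw [h2] at h1
      have h3 := S.add_mem (S.smul_mem (ν ((j + 1 : ℕ) : ZMod n)) ih) h1
      rw [hstep, mul_smul]
      convert h3 using 1
      rw [smul_sub]
      abel
  have hfull : ((p : ℤ) ^ f - 1) • (Pi.single 0 1 : ZMod n → ℤ) ∈ S := by
    have h := hmod n
    have hne : n / e = f := by rw [hn]; exact Nat.mul_div_cancel_left f he
    rw [hne, ZMod.natCast_self] at h
    rwa [sub_smul, one_smul]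
  refine ⟨?_, ?_⟩
  · intro y
    obtain ⟨z, rfl⟩ := ZMod.intCast_surjective y
    refine ⟨z • Pi.single 0 1, ?_⟩
    change Φ _ = _
    rw [map_zsmul, hΦs]
    simp
  · intro k
    constructor
    · intro hk
      have hk' : ((∑ r : ZMod n, k r * (p : ℤ) ^ (r.val / e) : ℤ) : ZMod (p ^ f - 1)) = 0 := by
        push_cast
        exact hk
      rw [ZMod.intCast_zmod_eq_zero_iff_dvd, Nat.cast_sub hpf] at hk'
      push_cast at hk'
      obtain ⟨c, hc⟩ := hk'
      have h1 : ∑ r : ZMod n, k r • ((p : ℤ) ^ (r.val / e) • (Pi.single 0 1 : ZMod n → ℤ)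
          - Pi.single r 1) ∈ S := by
        refine S.sum_mem fun r _ => S.smul_mem _ ?_
        have := hmod r.val
        rwa [ZMod.natCast_zmod_val] at this
      have h2 : ∑ r : ZMod n, k r • (Pi.single r 1 : ZMod n → ℤ) = k := by
        ext s
        simp [Finset.sum_apply, Pi.single_apply]
      simp only [smul_sub, Finset.sum_sub_distrib, smul_smul] at h1
      rw [h2, ← Finset.sum_smul, hc, mul_comm, mul_smul] at h1
      exact (S.sub_mem_iff_right (S.smul_mem c hfull)).mp h1
    · intro hk
      change Φ k = 0
      have hle : S ≤ LinearMap.ker Φ.toIntLinearMap := by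
        rw [hS, Submodule.span_le]
        rintro _ ⟨r, rfl⟩
        change Φ _ = 0
        rw [map_sub, map_zsmul, hΦs, hΦs]
        obtain ⟨j, hj, hr⟩ : ∃ j : ℕ, j < n ∧ r - 1 = (j : ZMod n) :=
          ⟨(r - 1).val, ZMod.val_lt _, (ZMod.natCast_zmod_val _).symm⟩
        have hr' : r = ((j + 1 : ℕ) : ZMod n) := by
          push_cast; rw [← hr]; ring
        have h3 := congrArg (Int.cast : ℤ → ZMod (p ^ f - 1)) (hstep j)
        push_cast at h3
        rw [hr, ZMod.val_natCast, Nat.mod_eq_of_lt hj, hr', ZMod.val_natCast, zsmul_eq_mul]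
        push_cast
        rw [← h3, sub_eq_zero]
        rcases Nat.lt_or_ge (j + 1) n with h | h
        · rw [Nat.mod_eq_of_lt h]
        · have : j + 1 = n := by omega
          have hne : n / e = f := by rw [hn]; exact Nat.mul_div_cancel_left f he
          rw [this, hne, hM]
          simp
      exact hle hk
end

section
/- Let n ≥ 1 and let ν : ℤ/nℤ → ℤ satisfy ν(r) ≥ 1 for all r and ∏_{r ∈ ℤ/nℤ} ν(r) ≥ 2. Suppose k : ℤ/nℤ → ℤ satisfies ν(r)·k(r) ≥ k(r−1) for all r ∈ ℤ/nℤ. Then k(r) ≥ 0 for all r; moreover, if in addition k(r₀) = 0 for some r₀ ∈ ℤ/nℤ, then k(r) = 0 for all r ∈ ℤ/nℤ. -/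
lemma stmt_9_induct (n : ℕ) [NeZero n] (P : ZMod n → Prop) (hP : ∀ r, P r → P (r - 1))
    (r₀ : ZMod n) (h : P r₀) (r : ZMod n) : P r := by
  have key : ∀ j : ℕ, P (r₀ - (j : ZMod n)) := by
    intro j
    induction j with
    | zero => simpa using h
    | succ j ih =>
      have := hP _ ih
      rwa [sub_sub, ← Nat.cast_succ] at this
  have := key (r₀ - r).val
  rwa [ZMod.natCast_zmod_val, sub_sub_cancel] at this

/-- if `ν(r) ≥ 1` for all `r`, `∏_r ν(r) ≥ 2`, and `k : ℤ/nℤ → ℤ` satisfies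
`ν(r)·k(r) ≥ k(r−1)` for all `r`, then `k(r) ≥ 0` for all `r`; and if moreover
`k(r₀) = 0` for some `r₀`, then `k = 0`. -/
theorem stmt_9 (n : ℕ) [NeZero n] (hn : 1 ≤ n) (ν : ZMod n → ℤ)
    (hν : ∀ r, 1 ≤ ν r) (hP : 2 ≤ ∏ r : ZMod n, ν r)
    (k : ZMod n → ℤ) (hk : ∀ r : ZMod n, k (r - 1) ≤ ν r * k r) :
    (∀ r : ZMod n, 0 ≤ k r) ∧
    (∀ r₀ : ZMod n, k r₀ = 0 → ∀ r : ZMod n, k r = 0) := by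
  have h0 : ∀ r : ZMod n, 0 ≤ k r := by
    obtain ⟨s, hs⟩ := Finite.exists_min k
    by_contra! hneg
    obtain ⟨t, ht⟩ := hneg
    have hm : k s < 0 := lt_of_le_of_lt (hs t) ht
    have hall : ∀ r, k r = k s := by
      apply stmt_9_induct n (fun r => k r = k s) _ s rfl
      intro r hr
      have h1 := hk r
      have h2 := hν r
      have h3 := hs (r - 1)
      rw [hr] at h1
      show k (r - 1) = k s
      nlinarith
    have hone : ∀ r, ν r = 1 := by
      intro r
      have h1 := hk r
      have h2 := hν r
      rw [hall r, hall (r - 1)] at h1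
      nlinarith
    simp [hone] at hP
  refine ⟨h0, fun r₀ hr₀ => stmt_9_induct n (fun r => k r = 0) ?_ r₀ hr₀⟩
  intro r hr
  have h1 := hk r
  have hr' : k r = 0 := hr
  rw [hr', mul_zero] at h1
  exact le_antisymm h1 (h0 _)
end

section
/- Let n ≥ 1 and let ν : ℤ/nℤ → ℤ satisfy ν(r) ≥ 1 for all r, and set P := ∏_{r ∈ ℤ/nℤ} ν(r); assume P ≥ 2. Define h_r := ν(r)·e_{r−1} − e_r in ℤ^{ℤ/nℤ}. Suppose k : ℤ/nℤ → ℤ satisfies ν(r)·k(r) ≥ k(r−1) for all r. Then there exist unique rational numbers s(r) for r ∈ ℤ/nℤ such that k = Σ_{r} s(r)·h_r, and they satisfy s(r) ≥ 0 and (P−1)·s(r) ∈ ℤ for all r; explicitly, (P−1)·s(φ) = Σ_{t=0}^{n−1} (∏_{u=1}^{t} ν(φ+u))·k(φ+t) for each φ ∈ ℤ/nℤ. -/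
lemma prod_Icc_one_range (f : ℕ → ℤ) (m : ℕ) :
    ∏ u ∈ Finset.Icc 1 m, f u = ∏ u ∈ Finset.range m, f (u + 1) := by
  induction m with
  | zero => simp
  | succ m ih => rw [Finset.prod_Icc_succ_top (by omega), Finset.prod_range_succ, ih]

/-- The product of `ν` over a full cycle starting after `r`. -/
lemma cyc_prod (n : ℕ) [NeZero n] (ν : ZMod n → ℤ) (r : ZMod n) :
    ∏ u ∈ Finset.Icc 1 n, ν (r + (u : ZMod n)) = ∏ r' : ZMod n, ν r' := by
  have h1 : ∏ u ∈ Finset.Icc 1 n, ν (r + (u : ZMod n))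
      = ∏ u ∈ Finset.range n, ν (r + ((u + 1 : ℕ) : ZMod n)) := by
    exact prod_Icc_one_range (fun u => ν (r + (u : ZMod n))) n
  rw [h1]
  refine Finset.prod_bij' (fun u _ => r + ((u + 1 : ℕ) : ZMod n))
    (fun x _ => (x - r - 1).val) ?_ ?_ ?_ ?_ ?_
  · intro a _; simp
  · intro a _; simpa using ZMod.val_lt (a - r - 1)
  · intro a ha
    have h : r + ((a + 1 : ℕ) : ZMod n) - r - 1 = (a : ZMod n) := by push_cast; ring
    simp only [h]
    exact ZMod.val_cast_of_lt (by simpa using ha)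
  · intro a _
    push_cast
    rw [ZMod.natCast_zmod_val]; ring
  · intro a _; rfl

lemma prod_Icc_step (n : ℕ) (ν : ZMod n → ℤ) (r : ZMod n) (t : ℕ) :
    ∏ u ∈ Finset.Icc 1 (t + 1), ν (r + (u : ZMod n))
      = (∏ u ∈ Finset.Icc 1 t, ν (r + (u : ZMod n))) * ν (r + t + 1) := by
  rw [Finset.prod_Icc_succ_top (by omega)]
  push_cast
  rw [add_assoc]

lemma prod_Icc_shift (n : ℕ) (ν : ZMod n → ℤ) (r : ZMod n) (t : ℕ) :
    ν (r + 1) * ∏ u ∈ Finset.Icc 1 t, ν (r + 1 + (u : ZMod n))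
      = ∏ u ∈ Finset.Icc 1 (t + 1), ν (r + (u : ZMod n)) := by
  induction t with
  | zero => simp
  | succ t ih =>
    rw [prod_Icc_step, ← mul_assoc, ih, prod_Icc_step n ν r (t + 1)]
    congr 2
    push_cast
    ring

/-- if `ν(r) ≥ 1` for all `r`, `P = ∏_r ν(r) ≥ 2`, and `k : ℤ/nℤ → ℤ`
satisfies `ν(r)·k(r) ≥ k(r−1)` for all `r`, then there are unique rationals `s(r)` with
`k = Σ_r s(r)·h_r` (componentwise: `k(c) = ν(c+1)·s(c+1) − s(c)`), and they satisfy
`s(r) ≥ 0`, `(P−1)·s(r) ∈ ℤ`, and the explicit formula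
`(P−1)·s(φ) = Σ_{t=0}^{n−1} (∏_{u=1}^{t} ν(φ+u))·k(φ+t)`. -/
theorem stmt_10 (n : ℕ) [NeZero n] (hn : 1 ≤ n) (ν : ZMod n → ℤ)
    (hν : ∀ r, 1 ≤ ν r) (hP : 2 ≤ ∏ r : ZMod n, ν r)
    (k : ZMod n → ℤ) (hk : ∀ r : ZMod n, k (r - 1) ≤ ν r * k r) :
    (∃! s : ZMod n → ℚ,
       ∀ c : ZMod n, (k c : ℚ) = (ν (c + 1) : ℚ) * s (c + 1) - s c) ∧
    (∀ s : ZMod n → ℚ,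
       (∀ c : ZMod n, (k c : ℚ) = (ν (c + 1) : ℚ) * s (c + 1) - s c) →
       ∀ r : ZMod n,
         0 ≤ s r ∧
         (∃ m : ℤ, (((∏ r' : ZMod n, ν r') - 1 : ℤ) : ℚ) * s r = (m : ℚ)) ∧
         (((∏ r' : ZMod n, ν r') - 1 : ℤ) : ℚ) * s r =
           ((∑ t ∈ Finset.range n,
              (∏ u ∈ Finset.Icc 1 t, ν (r + (u : ZMod n))) * k (r + (t : ZMod n)) : ℤ) : ℚ)) := by
  set P : ℤ := ∏ r' : ZMod n, ν r' with hPdef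
  have hP0 : (0 : ℚ) < ((P - 1 : ℤ) : ℚ) := by exact_mod_cast (by omega : (0 : ℤ) < P - 1)
  -- the explicit formula
  have key : ∀ s : ZMod n → ℚ,
      (∀ c : ZMod n, (k c : ℚ) = (ν (c + 1) : ℚ) * s (c + 1) - s c) → ∀ r : ZMod n,
      ((P - 1 : ℤ) : ℚ) * s r = ((∑ t ∈ Finset.range n,
        (∏ u ∈ Finset.Icc 1 t, ν (r + (u : ZMod n))) * k (r + (t : ZMod n)) : ℤ) : ℚ) := by
    intro s hs r
    have aux : ∀ m : ℕ, ((∑ t ∈ Finset.range m,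
        (∏ u ∈ Finset.Icc 1 t, ν (r + (u : ZMod n))) * k (r + (t : ZMod n)) : ℤ) : ℚ)
        = ((∏ u ∈ Finset.Icc 1 m, ν (r + (u : ZMod n)) : ℤ) : ℚ) * s (r + m) - s r := by
      intro m
      induction m with
      | zero => simp
      | succ m ih =>
        rw [Finset.sum_range_succ, Int.cast_add, ih, prod_Icc_step, Int.cast_mul, Int.cast_mul,
          hs (r + m), Nat.cast_succ, ← add_assoc]
        ring
    rw [aux n, cyc_prod, ← hPdef]
    simp only [CharP.cast_eq_zero, add_zero]
    push_cast
    ring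
  have knn : ∀ c, 0 ≤ k c := by
    intro c
    have aux : ∀ m : ℕ, k c ≤ (∏ u ∈ Finset.Icc 1 m, ν (c + (u : ZMod n))) * k (c + m) := by
      intro m
      induction m with
      | zero => simp
      | succ m ih =>
        have h1 := hk (c + m + 1)
        rw [add_sub_cancel_right] at h1
        have h2 : 0 ≤ ∏ u ∈ Finset.Icc 1 m, ν (c + (u : ZMod n)) :=
          Finset.prod_nonneg fun i _ => by linarith [hν (c + (i : ZMod n))]
        rw [prod_Icc_step, Nat.cast_succ, ← add_assoc, mul_assoc]
        exact ih.trans (mul_le_mul_of_nonneg_left h1 h2)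
    have h := aux n
    rw [cyc_prod] at h
    simp only [CharP.cast_eq_zero, add_zero] at h
    rw [← hPdef] at h
    by_contra hc
    push Not at hc
    nlinarith
  refine ⟨⟨fun r => ((∑ t ∈ Finset.range n,
      (∏ u ∈ Finset.Icc 1 t, ν (r + (u : ZMod n))) * k (r + (t : ZMod n)) : ℤ) : ℚ)
        / ((P - 1 : ℤ) : ℚ), ?_, ?_⟩, ?_⟩
  · intro c
    have hF : ν (c + 1) * (∑ t ∈ Finset.range n,
        (∏ u ∈ Finset.Icc 1 t, ν (c + 1 + (u : ZMod n))) * k (c + 1 + (t : ZMod n)))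
        - (∑ t ∈ Finset.range n,
        (∏ u ∈ Finset.Icc 1 t, ν (c + (u : ZMod n))) * k (c + (t : ZMod n)))
        = (P - 1) * k c := by
      have h := Finset.sum_range_sub (fun t : ℕ =>
        (∏ u ∈ Finset.Icc 1 t, ν (c + (u : ZMod n))) * k (c + (t : ZMod n))) n
      rw [cyc_prod, ← hPdef, Finset.sum_sub_distrib] at h
      simp only [CharP.cast_eq_zero, add_zero, Nat.cast_zero] at h
      have e : ν (c + 1) * (∑ t ∈ Finset.range n,
          (∏ u ∈ Finset.Icc 1 t, ν (c + 1 + (u : ZMod n))) * k (c + 1 + (t : ZMod n)))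
          = ∑ t ∈ Finset.range n, (∏ u ∈ Finset.Icc 1 (t + 1), ν (c + (u : ZMod n)))
            * k (c + ((t + 1 : ℕ) : ZMod n)) := by
        rw [Finset.mul_sum]
        refine Finset.sum_congr rfl fun t _ => ?_
        rw [← mul_assoc, prod_Icc_shift]
        congr 2
        push_cast
        ring
      rw [e, h]
      simp
      ring
    have hF' := congrArg (fun z : ℤ => (z : ℚ)) hF
    simp only [Int.cast_sub (ν (c + 1) * _), Int.cast_mul (ν (c + 1)), Int.cast_mul (P - 1)] at hF'
    beta_reduce
    rw [← mul_div_assoc, ← sub_div, hF', mul_div_cancel_left₀ _ hP0.ne']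
  · intro s hs
    funext r
    rw [← key s hs r, mul_div_cancel_left₀ _ hP0.ne']
  · intro s hs r
    have h := key s hs r
    refine ⟨?_, ⟨_, h⟩, h⟩
    refine nonneg_of_mul_nonneg_right (b := s r) (a := ((P - 1 : ℤ) : ℚ)) ?_ hP0
    rw [h]
    exact_mod_cast Finset.sum_nonneg fun t _ => mul_nonneg
      (Finset.prod_nonneg fun i _ => by linarith [hν (r + (i : ZMod n))]) (knn _)
end

section
/- Let p ≥ 2 and e, f ≥ 1 be integers with n := e·f > 1 and p^f > 3. Define ν : ℤ/nℤ → ℤ by ν(r) = p if r lies in the subgroup e·(ℤ/nℤ) and ν(r) = 1 otherwise, and define h_r := ν(r)·e_{r−1} − e_r in ℤ^{ℤ/nℤ}. Let θ₀ := −1 ∈ ℤ/nℤ. Then there is no function m : ℤ/nℤ → ℤ with m(r) ≥ 0 for all r such that the element k := 2·e_{θ₀} − Σ_{r ∈ ℤ/nℤ} m(r)·h_r satisfies ν(r)·k(r) ≥ k(r−1) for all r ∈ ℤ/nℤ. (Equivalently, writing k(r) = 2·δ_{r,θ₀} + m(r) − ν(r+1)·m(r+1), no nonnegative integer solution m exists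 to the system ν(r)·k(r) ≥ k(r−1) for all r.) -/
/-- for `n = e·f > 1` and `p^f > 3`, with `ν = p` on the subgroup
`e·(ℤ/nℤ)` and `ν = 1` elsewhere, and `θ₀ = −1 ∈ ℤ/nℤ`, there is no nonnegative
`m : ℤ/nℤ → ℤ` such that `k = 2·e_{θ₀} − Σ_r m(r)·h_r` (with
`h_r = ν(r)·e_{r−1} − e_r`) satisfies `ν(r)·k(r) ≥ k(r−1)` for all `r`. -/
theorem stmt_12 (p e f : ℕ) (hp : 2 ≤ p) (he : 1 ≤ e) (hf : 1 ≤ f)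
    (n : ℕ) (hn : n = e * f) [NeZero n] (hn1 : 1 < n) (hpf : 3 < p ^ f)
    (ν : ZMod n → ℤ)
    (hν1 : ∀ r : ZMod n, (∃ x : ZMod n, r = (e : ZMod n) * x) → ν r = p)
    (hν2 : ∀ r : ZMod n, (¬ ∃ x : ZMod n, r = (e : ZMod n) * x) → ν r = 1) :
    ¬ ∃ m : ZMod n → ℤ, (∀ r : ZMod n, 0 ≤ m r) ∧
      (∀ r : ZMod n,
        (((2 : ℤ) • Pi.single (-1 : ZMod n) (1 : ℤ)
          - ∑ r' : ZMod n,
              m r' • (ν r' • Pi.single (r' - 1) (1 : ℤ) - Pi.single r' 1)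
            : ZMod n → ℤ)) (r - 1)
        ≤ ν r *
        (((2 : ℤ) • Pi.single (-1 : ZMod n) (1 : ℤ)
          - ∑ r' : ZMod n,
              m r' • (ν r' • Pi.single (r' - 1) (1 : ℤ) - Pi.single r' 1)
            : ZMod n → ℤ)) r) := by
  rintro ⟨m, hm, hk⟩
  obtain ⟨K, hK⟩ : ∃ K : ZMod n → ℤ, K = ((2 : ℤ) • Pi.single (-1 : ZMod n) (1 : ℤ)
          - ∑ r' : ZMod n,
              m r' • (ν r' • Pi.single (r' - 1) (1 : ℤ) - Pi.single r' 1)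
            : ZMod n → ℤ) := ⟨_, rfl⟩
  rw [← hK] at hk
  have hKf : ∀ r, K r = (if r = -1 then 2 else 0) + m r - ν (r + 1) * m (r + 1) := by
    intro r
    rw [hK]
    simp only [Pi.sub_apply, Finset.sum_apply, Pi.smul_apply, smul_eq_mul, Pi.single_apply,
      mul_sub, Finset.sum_sub_distrib]
    have h1 : ∑ x : ZMod n, m x * (ν x * if r = x - 1 then 1 else 0)
        = ν (r + 1) * m (r + 1) := by
      rw [Finset.sum_eq_single (r + 1)]
      · simp [mul_comm]
      · intro b _ hb
        rw [if_neg]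
        · simp
        · intro h
          exact hb (by rw [h]; ring)
      · simp
    rw [h1]
    simp
    ring
  clear hK
  have hν0 : ν 0 = p := hν1 0 ⟨0, by simp⟩
  have hνpos : ∀ r, 1 ≤ ν r := by
    intro r
    by_cases h : ∃ x : ZMod n, r = (e : ZMod n) * x
    · rw [hν1 r h]; exact_mod_cast (by omega : 1 ≤ p)
    · rw [hν2 r h]
  have hp' : (2 : ℤ) ≤ p := by exact_mod_cast hp
  have h10 : (0 : ZMod n) ≠ -1 := by
    intro h
    haveI : Fact (1 < n) := ⟨hn1⟩
    have h2 : (1 : ZMod n) = 0 := by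
      rw [← neg_eq_zero]; exact h.symm
    exact one_ne_zero h2
  obtain ⟨Q, hQ⟩ : ∃ Q : ℕ → ℤ, ∀ j, Q j = ∏ i ∈ Finset.range j, ν (i : ZMod n) :=
    ⟨_, fun _ => rfl⟩
  have hQs : ∀ j, Q (j + 1) = Q j * ν (j : ZMod n) := by
    intro j; rw [hQ, hQ, Finset.prod_range_succ]
  have hQ0 : Q 0 = 1 := by rw [hQ]; simp
  have hQpos : ∀ j, 1 ≤ Q j := by
    intro j
    induction j with
    | zero => rw [hQ0]
    | succ j ih => rw [hQs]; nlinarith [hνpos (j : ZMod n)]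
  have hQmono : Monotone Q := by
    apply monotone_nat_of_le_succ
    intro j
    rw [hQs]; nlinarith [hνpos (j : ZMod n), hQpos j]
  have hQp : ∀ j : ℕ, (p : ℤ) ^ j ≤ Q (e * j) := by
    intro j
    induction j with
    | zero => simp [hQ0]
    | succ j ih =>
      have h1 : Q (e * j + 1) ≤ Q (e * (j + 1)) := hQmono (by rw [mul_add]; omega)
      rw [hQs, hν1 _ ⟨(j : ZMod n), by push_cast; rfl⟩] at h1
      rw [pow_succ]
      nlinarith
  have hQn : 4 ≤ Q n := by
    have h1 := hQp f
    rw [← hn] at h1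
    have h2 : (4 : ℤ) ≤ (p : ℤ) ^ f := by exact_mod_cast hpf
    linarith
  obtain ⟨N, hN⟩ : ∃ N, n = N + 1 := ⟨n - 1, by omega⟩
  have hNc : (N : ZMod n) = -1 := by
    have h1 : ((N + 1 : ℕ) : ZMod n) = 0 := by rw [← hN]; simp
    push_cast at h1
    exact eq_neg_of_add_eq_zero_left h1
  -- the values of K are nonnegative
  have hKQ : ∀ j : ℕ, K (-1) ≤ Q (j + 1) * K (j : ZMod n) := by
    intro j
    induction j with
    | zero =>
      have := hk 0
      rw [hQs, hQ0]
      simpa using this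
    | succ j ih =>
      have h1 := hk ((j + 1 : ℕ) : ZMod n)
      have h2 : (((j + 1 : ℕ) : ZMod n) - 1) = (j : ZMod n) := by push_cast; ring
      rw [h2] at h1
      rw [hQs (j + 1), mul_assoc]
      have h3 := hQpos (j + 1)
      exact ih.trans (mul_le_mul_of_nonneg_left h1 (by linarith))
  have hKm1 : 0 ≤ K (-1) := by
    have h1 := hKQ N
    rw [← hN, hNc] at h1
    nlinarith
  have hKnn : ∀ j : ℕ, 0 ≤ K (j : ZMod n) := by
    intro j
    have h1 := hKQ j
    have h2 := hQpos (j + 1)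
    by_contra h3
    push Not at h3
    nlinarith
  have hMQ : ∀ j : ℕ, j < n → Q (j + 1) * m (j : ZMod n) ≤ p * m 0 := by
    intro j
    induction j with
    | zero => intro _; rw [hQs, hQ0]; simp [hν0]
    | succ j ih =>
      intro hj
      have h0 := ih (by omega)
      have h1 := hKnn j
      rw [hKf, if_neg] at h1
      · have h3 := hQpos (j + 1)
        rw [hQs (j + 1), mul_assoc]
        push_cast
        refine le_trans (mul_le_mul_of_nonneg_left ?_ (by linarith)) h0
        linarith
      · intro h
        have h4 : ((j + 1 : ℕ) : ZMod n) = 0 := by push_cast; rw [h]; ring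
        rw [ZMod.natCast_eq_zero_iff] at h4
        have := Nat.le_of_dvd (by omega) h4
        omega
  have hKe : K (-1) = 2 + m (-1) - p * m 0 := by
    rw [hKf]; simp [hν0]
  have hm1 : m (-1) = 0 := by
    have h1 := hMQ N (by omega)
    rw [← hN, hNc] at h1
    have := hm (-1)
    nlinarith
  have hm0 : 1 ≤ m 0 := by
    by_contra h
    have h0 : m 0 = 0 := by have := hm 0; omega
    have h1 := hk 0
    rw [zero_sub, hKe, hKf 0, if_neg h10, h0, hm1, hν0] at h1
    have h2 : 0 ≤ ν (0 + 1) * m (0 + 1) := mul_nonneg (by linarith [hνpos (0 + 1)]) (hm _)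
    nlinarith
  have hKz : K (-1) = 0 := by nlinarith
  have hKle : ∀ i : ℕ, K (-1 - (i : ZMod n)) ≤ 0 := by
    intro i
    induction i with
    | zero => simp [hKz]
    | succ i ih =>
      have h1 := hk (-1 - (i : ZMod n))
      have h2 : (-1 - ((i + 1 : ℕ) : ZMod n)) = -1 - (i : ZMod n) - 1 := by push_cast; ring
      rw [h2]
      nlinarith [hνpos (-1 - (i : ZMod n))]
  have hMle : ∀ i : ℕ, m (-1 - (i : ZMod n)) ≤ 0 := by
    intro i
    induction i with
    | zero => simp [hm1]
    | succ i ih =>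
      have h1 := hKle (i + 1)
      rw [hKf] at h1
      have h2 : (-1 - ((i + 1 : ℕ) : ZMod n)) + 1 = -1 - (i : ZMod n) := by push_cast; ring
      rw [h2] at h1
      have h3 := hνpos (-1 - (i : ZMod n))
      split_ifs at h1 <;> nlinarith
  have h1 := hMle N
  rw [hNc, sub_self] at h1
  linarith
end
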